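/- Let B, G, R be pairwise disjoint sets of n points each with B ∪ G in general position, such that every line through b ∈ B and g ∈ G contains a point r ∈ R not between b and g. Then B ∪ G ∪ R is contained in a cubic curve. -/

import Mathlib

abbrev Pt := Fin 2 → ℝ

def GenPos (S : Set Pt) : Prop :=
  ∀ x ∈ S, ∀ y ∈ S, ∀ z ∈ S, x ≠ y → x ≠ z → y ≠ z → ¬ Collinear ℝ ({x, y, z} : Set Pt)

/-- Signed area of the triangle `p q x` (twice). -/
def dt (p q x : Pt) : ℝ := (q 0 - p 0) * (x 1 - p 1) - (q 1 - p 1) * (x 0 - p 0)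

theorem dt_rot (p q x : Pt) : dt p q x = dt q x p := by unfold dt; ring
theorem dt_swap (p q x : Pt) : dt p q x = - dt p x q := by unfold dt; ring
theorem dt_swap' (p q x : Pt) : dt p q x = - dt q p x := by unfold dt; ring

theorem dt_trans (q w a b c : Pt) (ha : 0 ≤ dt q w a) (hb : 0 < dt q w b) (hc : 0 ≤ dt q w c)
    (hac : 0 < dt q w a ∨ 0 < dt q w c)
    (hab : 0 < dt q a b) (hbc : 0 < dt q b c) : 0 < dt q a c := by
  have key : dt q w b * dt q a c = dt q w a * dt q b c + dt q w c * dt q a b := by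
    unfold dt; ring
  have : 0 < dt q w b * dt q a c := by
    rw [key]
    rcases hac with h | h
    · have := mul_pos h hbc
      have := mul_nonneg hc hab.le
      linarith
    · have := mul_pos h hab
      have := mul_nonneg ha hbc.le
      linarith
  exact (pos_iff_pos_of_mul_pos this).1 hb

/-- cotangent-type order function at `q`, with direction from `p` to `q`. -/
noncomputable def ct (p q x : Pt) : ℝ :=
  ((q 0 - p 0) * (x 0 - q 0) + (q 1 - p 1) * (x 1 - q 1)) / dt p q x

def nrm (p q : Pt) : ℝ := (q 0 - p 0) ^ 2 + (q 1 - p 1) ^ 2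

theorem ne_of_dt {p q x : Pt} (h : dt p q x ≠ 0) : 0 < nrm p q := by
  unfold nrm
  by_contra hh
  have h0 : q 0 - p 0 = 0 := by nlinarith [sq_nonneg (q 0 - p 0), sq_nonneg (q 1 - p 1)]
  have h1 : q 1 - p 1 = 0 := by nlinarith [sq_nonneg (q 0 - p 0), sq_nonneg (q 1 - p 1)]
  apply h; unfold dt; rw [h0, h1]; ring

theorem ct_sub (p q x y : Pt) (hx : dt p q x ≠ 0) (hy : dt p q y ≠ 0) :
    (ct p q x - ct p q y) * (dt p q x * dt p q y) = nrm p q * dt q x y := by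
  have : (ct p q x - ct p q y) * (dt p q x * dt p q y) =
    ((q 0 - p 0) * (x 0 - q 0) + (q 1 - p 1) * (x 1 - q 1)) * dt p q y -
    ((q 0 - p 0) * (y 0 - q 0) + (q 1 - p 1) * (y 1 - q 1)) * dt p q x := by
    unfold ct; field_simp
  rw [this]; unfold dt nrm; ring

theorem exists_first (p q : Pt) (X : Finset Pt) (hX : X.Nonempty) (h : ∀ x ∈ X, 0 < dt p q x) :
    ∃ x ∈ X, ∀ y ∈ X, 0 ≤ dt q x y := by
  obtain ⟨x, hx, hm⟩ := X.exists_max_image (ct p q) hX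
  refine ⟨x, hx, fun y hy => ?_⟩
  have e := ct_sub p q x y (h x hx).ne' (h y hy).ne'
  have : 0 ≤ nrm p q * dt q x y := by
    rw [← e]
    exact mul_nonneg (sub_nonneg.2 (hm y hy)) (mul_pos (h x hx) (h y hy)).le
  exact nonneg_of_mul_nonneg_right this (ne_of_dt (h x hx).ne')

theorem exists_last (p q : Pt) (X : Finset Pt) (hX : X.Nonempty) (h : ∀ x ∈ X, 0 < dt p q x) :
    ∃ x ∈ X, ∀ y ∈ X, 0 ≤ dt q y x := by
  obtain ⟨x, hx, hm⟩ := X.exists_min_image (ct p q) hX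
  refine ⟨x, hx, fun y hy => ?_⟩
  have e := ct_sub p q y x (h y hy).ne' (h x hx).ne'
  have : 0 ≤ nrm p q * dt q y x := by
    rw [← e]
    exact mul_nonneg (sub_nonneg.2 (hm y hy)) (mul_pos (h y hy) (h x hx)).le
  exact nonneg_of_mul_nonneg_right this (ne_of_dt (h x hx).ne')

structure Cfg (A S R : Finset Pt) (ρ : Pt → Pt → Pt) : Prop where
  disj : ∀ a ∈ A, ∀ s ∈ S, a ≠ s
  disjA : ∀ a ∈ A, ∀ r ∈ R, a ≠ r
  disjS : ∀ s ∈ S, ∀ r ∈ R, s ≠ r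
  gp : ∀ x ∈ A ∪ S, ∀ y ∈ A ∪ S, ∀ z ∈ A ∪ S, x ≠ y → x ≠ z → y ≠ z → dt x y z ≠ 0
  mem : ∀ a ∈ A, ∀ s ∈ S, ρ a s ∈ R
  surjS : ∀ a ∈ A, ∀ r ∈ R, ∃ s ∈ S, ρ a s = r
  surjA : ∀ s ∈ S, ∀ r ∈ R, ∃ a ∈ A, ρ a s = r
  injS : ∀ a ∈ A, ∀ s ∈ S, ∀ s' ∈ S, ρ a s = ρ a s' → s = s'
  injA : ∀ s ∈ S, ∀ a ∈ A, ∀ a' ∈ A, ρ a s = ρ a' s → a = a'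
  line : ∀ a ∈ A, ∀ s ∈ S, ∃ t : ℝ, 0 < t * (t - 1) ∧ ∀ i, ρ a s i = a i + t * (s i - a i)
  cardA : 2 ≤ A.card
  cardEq : A.card = S.card

theorem Cfg.swap {A S R ρ} (h : Cfg A S R ρ) : Cfg S A R (fun s a => ρ a s) where
  disj := fun a ha s hs => (h.disj s hs a ha).symm
  disjA := h.disjS
  disjS := h.disjA
  gp := by rw [Finset.union_comm]; exact h.gp
  mem := fun a ha s hs => h.mem s hs a ha
  surjS := h.surjA
  surjA := h.surjS
  injS := h.injA
  injA := h.injS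
  line := by
    intro a ha s hs
    obtain ⟨t, ht, e⟩ := h.line s hs a ha
    refine ⟨1 - t, by linarith, fun i => ?_⟩
    simp only [e]; ring
  cardA := h.cardEq ▸ h.cardA
  cardEq := h.cardEq.symm

section
variable {A S R : Finset Pt} {ρ : Pt → Pt → Pt}

theorem Cfg.dt_rho (h : Cfg A S R ρ) {a s} (ha : a ∈ A) (hs : s ∈ S) : dt a s (ρ a s) = 0 := by
  obtain ⟨t, ht, e⟩ := h.line a ha s hs
  unfold dt; rw [e, e]; ring

/-- same side lemma -/
theorem Cfg.side (h : Cfg A S R ρ) {p q s s'} (hp : p ∈ A) (hq : q ∈ A) (hs : s ∈ S) (hs' : s' ∈ S)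
    (hpq : p ≠ q) (e : ρ p s = ρ q s') : 0 < dt p s q * dt p s s' := by
  have h0 := h.dt_rho hp hs
  obtain ⟨t, ht, e'⟩ := h.line q hq s' hs'
  rw [e] at h0
  have hne : dt p s q ≠ 0 := h.gp p (by simp [hp]) s (by simp [hs]) q (by simp [hq])
    (h.disj p hp s hs) hpq (h.disj q hq s hs).symm
  have h1 : (1 - t) * dt p s q + t * dt p s s' = 0 := by
    rw [← h0]; unfold dt; rw [e', e']; ring
  have h2 : t ^ 2 * (dt p s q * dt p s s') = t * (t - 1) * (dt p s q) ^ 2 := by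
    linear_combination t * dt p s q * h1
  have h3 : 0 < t ^ 2 * (dt p s q * dt p s s') := by
    rw [h2]; exact mul_pos ht (by positivity)
  exact (pos_iff_pos_of_mul_pos h3).1 (by
    rcases eq_or_ne t 0 with rfl | h
    · simp at ht
    · positivity)

theorem Cfg.gpA (h : Cfg A S R ρ) {p q s} (hp : p ∈ A) (hq : q ∈ A) (hs : s ∈ S) (hpq : p ≠ q) :
    dt p q s ≠ 0 := h.gp p (by simp [hp]) q (by simp [hq]) s (by simp [hs]) hpq
      (h.disj p hp s hs) (h.disj q hq s hs)

/-- exactly one point of `S` on one side of `pq`. -/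
theorem Cfg.one_below (h : Cfg A S R ρ) {p q s1} (hp : p ∈ A) (hq : q ∈ A) (hs1 : s1 ∈ S)
    (hpq : p ≠ q) (hb : ∀ s ∈ S, s ≠ s1 → dt p q s * dt p q s1 < 0) :
    ∀ s ∈ S, s ≠ s1 → 0 < dt q s1 p * dt q s1 s := by
  -- k is maximal at s1
  obtain ⟨m, hm, hmax⟩ := S.exists_min_image (fun s => dt p q s1 * ct p q s) ⟨s1, hs1⟩
  have hms : m = s1 := by
    by_contra hne
    obtain ⟨s, hs, e⟩ := h.surjS q hq (ρ p m) (h.mem p hp m hm)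
    have sd := h.side hq hp hs hm hpq.symm e
    have e2 := ct_sub p q m s (h.gpA hp hq hm hpq) (h.gpA hp hq hs hpq)
    have hle := hmax s hs
    have hbm := hb m hm hne
    have hN := ne_of_dt (h.gpA hp hq hs1 hpq)
    have r1 : dt q s p = dt p q s := by unfold dt; ring
    have r2 : dt q s m = - dt q m s := by unfold dt; ring
    rw [r1, r2] at sd
    set x := dt p q s
    set y := dt q m s
    set hm' := dt p q m
    set h1 := dt p q s1
    set c := ct p q m - ct p q s with hc
    have hc' : h1 * c ≤ 0 := by rw [hc]; linarith
    have e3 : c * hm' * x ^ 2 < 0 := by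
      have : c * hm' * x ^ 2 = nrm p q * (x * y) := by linear_combination x * e2
      rw [this]; exact mul_neg_of_pos_of_neg hN (by linarith)
    have e4 : c * hm' < 0 := by
      by_contra hh
      have := mul_nonneg (not_lt.1 hh) (sq_nonneg x)
      linarith
    have e5 : 0 ≤ (h1 * c) * (hm' * h1) := mul_nonneg_of_nonpos_of_nonpos hc' hbm.le
    have e6 : (h1 * c) * (hm' * h1) = c * hm' * h1 ^ 2 := by ring
    have h1ne : h1 ≠ 0 := h.gpA hp hq hs1 hpq
    have : c * hm' * h1 ^ 2 < 0 := mul_neg_of_neg_of_pos e4 (by positivity)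
    linarith
  subst hms
  intro s hs hne
  have hle := hmax s hs
  have e2 := ct_sub p q m s (h.gpA hp hq hm hpq) (h.gpA hp hq hs hpq)
  have hbm := hb s hs hne
  have hN := ne_of_dt (h.gpA hp hq hs1 hpq)
  have r1 : dt q m p = dt p q m := by unfold dt; ring
  have hne0 : dt q m s ≠ 0 := h.gp q (by simp [hq]) m (by simp [hm]) s (by simp [hs])
    (h.disj q hq m hm) (h.disj q hq s hs) hne.symm
  have hne1 := h.gpA hp hq hm hpq
  rw [r1]
  have e3 : 0 ≤ nrm p q * (dt p q m * dt q m s) := by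
    have : nrm p q * (dt p q m * dt q m s) =
      (dt p q m * (ct p q m - ct p q s)) * (dt p q s * dt p q m) := by
      linear_combination (-(dt p q m)) * e2
    rw [this]
    exact mul_nonneg_of_nonpos_of_nonpos (by linarith) hbm.le
  have e4 := nonneg_of_mul_nonneg_right e3 hN
  exact lt_of_le_of_ne e4 (mul_ne_zero hne1 hne0).symm

def Hull (P : Finset Pt) (x y : Pt) : Prop := ∀ z ∈ P, z ≠ x → z ≠ y → 0 < dt x y z

theorem Cfg.no_mono (h : Cfg A S R ρ) {p q} (hp : p ∈ A) (hq : q ∈ A) (hpq : p ≠ q)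
    (hh : Hull (A ∪ S) p q) : False := by
  have hSne : S.Nonempty := Finset.card_pos.1 (by have := h.cardA; have := h.cardEq; omega)
  have hpos : ∀ s ∈ S, 0 < dt p q s := fun s hs =>
    hh s (by simp [hs]) (h.disj p hp s hs).symm (h.disj q hq s hs).symm
  obtain ⟨s, hs, hl⟩ := exists_last p q S hSne hpos
  obtain ⟨s', hs', e⟩ := h.surjS p hp (ρ q s) (h.mem q hq s hs)
  have sd := h.side hq hp hs hs' hpq.symm e.symm
  have r1 : dt q s p = dt p q s := by unfold dt; ring
  rw [r1] at sd
  have := (pos_iff_pos_of_mul_pos sd).1 (hpos s hs)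
  have h2 := hl s' hs'
  rw [dt_swap] at h2
  linarith

/-- bicoloured edges cannot cut off just one point -/
theorem Cfg.not_one (h : Cfg A S R ρ) {p y b} (hp : p ∈ A) (hy : y ∈ S) (hb : b ∈ S) (hby : b ≠ y)
    (hneg : dt p y b < 0)
    (hh : ∀ x ∈ A ∪ S, x ≠ p → x ≠ y → x ≠ b → 0 < dt p y x) : False := by
  obtain ⟨a, ha, e⟩ := h.surjA b hb (ρ p y) (h.mem p hp y hy)
  have hap : p ≠ a := by
    rintro rfl
    exact hby (h.injS p hp b hb y hy e)
  have sd := h.side hp ha hy hb hap e.symm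
  have := hh a (by simp [ha]) hap.symm (h.disj a ha y hy) (h.disj a ha b hb)
  have := mul_neg_of_pos_of_neg this hneg
  linarith

theorem Cfg.next (h : Cfg A S R ρ) {g b} (hg : g ∈ A) (hb : b ∈ S) (hh : Hull (A ∪ S) g b) :
    ∃ g' ∈ A, g' ≠ g ∧ Hull (A ∪ S) b g' ∧
      ∀ x ∈ A ∪ S, x ≠ g → x ≠ g' → x ≠ b → 0 < dt g g' x := by
  have hgb := h.disj g hg b hb
  obtain ⟨a', ha', hag⟩ := Finset.exists_mem_ne (by have := h.cardA; omega : 1 < A.card) g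
  obtain ⟨s', hs', hsb⟩ := Finset.exists_mem_ne
    (by have := h.cardA; have := h.cardEq; omega : 1 < S.card) b
  have hgP : g ∈ A ∪ S := by simp [hg]
  have hbP : b ∈ A ∪ S := by simp [hb]
  have hs'P : s' ∈ A ∪ S := by simp [hs']
  have ha'P : a' ∈ A ∪ S := by simp [ha']
  let X := (A ∪ S).filter (fun x => x ≠ g ∧ x ≠ b)
  have hX : ∀ x, x ∈ X ↔ x ∈ A ∪ S ∧ x ≠ g ∧ x ≠ b := fun x => by simp only [X, Finset.mem_filter]
  have hXpos : ∀ x ∈ X, 0 < dt b g x → False := fun x hx hc => by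
    have := hh x ((hX x).1 hx).1 ((hX x).1 hx).2.1 ((hX x).1 hx).2.2
    rw [dt_swap'] at this; linarith
  -- first from g, with a reference point
  let o : Pt := fun i => 2 * g i - b i
  have ho : ∀ x, dt o g x = dt g b x := fun x => by simp only [dt, o]; ring
  obtain ⟨y, hyX, hy1⟩ := exists_first o g X ⟨s', (hX s').2 ⟨hs'P, (h.disj g hg s' hs').symm, hsb⟩⟩
    (fun x hx => by
      rw [ho]; exact hh x ((hX x).1 hx).1 ((hX x).1 hx).2.1 ((hX x).1 hx).2.2)
  obtain ⟨hyP, hyg, hyb⟩ := (hX y).1 hyX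
  have hy : ∀ x ∈ A ∪ S, x ≠ g → x ≠ y → x ≠ b → 0 < dt g y x := fun x hx h1 h2 h3 =>
    lt_of_le_of_ne (hy1 x ((hX x).2 ⟨hx, h1, h3⟩)) (h.gp g hgP y hyP x hx hyg.symm h1.symm h2.symm).symm
  have hgby := hh y hyP hyg hyb
  have hgyb : dt g y b < 0 := by rw [dt_swap]; linarith
  have hyA : y ∈ A := by
    by_contra hyA
    have hyS : y ∈ S := by
      rcases Finset.mem_union.1 hyP with h | h
      · exact absurd h hyA
      · exact h
    exact h.not_one hg hyS hb hyb.symm hgyb hy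
  refine ⟨y, hyA, hyg, ?_, hy⟩
  let Y := (A ∪ S).filter (fun x => x ≠ g ∧ x ≠ y ∧ x ≠ b)
  have hY : ∀ x, x ∈ Y ↔ x ∈ A ∪ S ∧ x ≠ g ∧ x ≠ y ∧ x ≠ b :=
    fun x => by simp only [Y, Finset.mem_filter]
  obtain ⟨z, hzY, hz1⟩ := exists_first g y Y
    ⟨s', (hY s').2 ⟨hs'P, (h.disj g hg s' hs').symm, (h.disj y hyA s' hs').symm, hsb⟩⟩
    (fun x hx => by
      obtain ⟨h0, h1, h2, h3⟩ := (hY x).1 hx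
      exact hy x h0 h1 h2 h3)
  obtain ⟨hzP, hzg, hzy, hzb⟩ := (hY z).1 hzY
  have hz : ∀ x ∈ A ∪ S, x ≠ y → x ≠ z → x ≠ b → 0 < dt y z x := fun x hx h1 h2 h3 => by
    rcases eq_or_ne x g with rfl | hxg
    · rw [← dt_rot]; exact hy z hzP hzg hzy hzb
    · exact lt_of_le_of_ne (hz1 x ((hY x).2 ⟨hx, hxg, h1, h3⟩))
        (h.gp y hyP z hzP x hx hzy.symm h1.symm h2.symm).symm
  have hzb0 : dt y z b ≠ 0 := h.gp y hyP z hzP b hbP hzy.symm hyb hzb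
  rcases lt_or_gt_of_ne hzb0 with hneg | hpos
  · exfalso
    have hzA : z ∈ A := by
      by_contra hzA
      have hzS : z ∈ S := by
        rcases Finset.mem_union.1 hzP with h | h
        · exact absurd h hzA
        · exact h
      exact h.not_one hyA hzS hb hzb.symm hneg hz
    have o1 := h.one_below hg hyA hb hyg.symm (fun s hs hsb => by
      exact mul_neg_of_pos_of_neg
        (hy s (by simp [hs]) (h.disj g hg s hs).symm (h.disj y hyA s hs).symm hsb) hgyb) s' hs' hsb
    have o2 := h.one_below hzA hyA hb hzy (fun s hs hsb => by
      rw [dt_swap' z y s, dt_swap' z y b, neg_mul_neg]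
      exact mul_neg_of_pos_of_neg
        (hz s (by simp [hs]) (h.disj y hyA s hs).symm (h.disj z hzA s hs).symm hsb) hneg) s' hs' hsb
    have e1 : dt y b g = dt g y b := by unfold dt; ring
    have e2 : dt y b z = - dt y z b := by unfold dt; ring
    rw [e1] at o1
    rw [e2] at o2
    have := (pos_iff_pos_of_mul_pos o2).1 (by linarith)
    have := mul_neg_of_neg_of_pos hgyb this
    linarith
  · intro w hw hwb hwy
    rcases eq_or_ne w g with rfl | hwg
    · rw [← dt_rot]; exact hgby
    rcases eq_or_ne w z with rfl | hwz
    · rw [dt_rot]; exact hpos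
    rw [dt_rot]
    refine dt_trans y z w g b (hz w hw hwy hwz hwb).le (hz g hgP hyg.symm hzg.symm hgb) hpos.le
      (Or.inr hpos) ?_ ?_
    · rw [← dt_rot]; exact hy w hw hwg hwy hwb
    · rw [← dt_rot, ← dt_rot]; exact hgby

theorem Cfg.exists_hull (h : Cfg A S R ρ) : ∃ g ∈ A, ∃ b ∈ S, Hull (A ∪ S) g b := by
  have hSc : 2 ≤ S.card := h.cardEq ▸ h.cardA
  have hne : (A ∪ S).Nonempty := by
    obtain ⟨a, ha⟩ := Finset.card_pos.1 (by have := h.cardA; omega : 0 < A.card)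
    exact ⟨a, by simp [ha]⟩
  have edge : ∃ x ∈ A ∪ S, ∃ y ∈ A ∪ S, x ≠ y ∧ Hull (A ∪ S) x y := by
    obtain ⟨p, hp, hmin⟩ := (A ∪ S).exists_min_image (fun x => x 0) hne
    by_cases hq : ∃ q ∈ A ∪ S, q ≠ p ∧ q 0 = p 0
    · obtain ⟨q, hq, hqp, e⟩ := hq
      have hlt : ∀ z ∈ A ∪ S, z ≠ p → z ≠ q → 0 < z 0 - p 0 := by
        intro z hz h1 h2
        have hd := h.gp p hp q hq z hz hqp.symm h1.symm h2.symm
        have hm := hmin z hz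
        refine lt_of_le_of_ne (by linarith) fun h0 => hd ?_
        unfold dt; rw [e, ← h0]; ring
      have h1 : q 1 ≠ p 1 := by
        intro h1
        apply hqp
        funext i; fin_cases i
        · exact e
        · exact h1
      rcases lt_or_gt_of_ne h1 with h1 | h1
      · refine ⟨p, hp, q, hq, hqp.symm, fun z hz a b => ?_⟩
        have := hlt z hz a b
        unfold dt; rw [e]; nlinarith
      · refine ⟨q, hq, p, hp, hqp, fun z hz a b => ?_⟩
        have := hlt z hz b a
        unfold dt; rw [e]; nlinarith
    · push Not at hq
      let o : Pt := fun i => p i + (i : ℕ)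
      have ho : ∀ x, dt o p x = x 0 - p 0 := fun x => by
        simp [dt, o]
      obtain ⟨a, ha⟩ : ∃ a ∈ A ∪ S, a ≠ p := Finset.exists_mem_ne
        (by have := h.cardA; have := Finset.card_le_card (Finset.subset_union_left (s₁ := A) (s₂ := S)); omega) p
      obtain ⟨y, hy, hf⟩ := exists_first o p ((A ∪ S).erase p) ⟨a, by simp only [Finset.mem_erase]; tauto⟩
        (fun x hx => by
          obtain ⟨h1, h2⟩ := Finset.mem_erase.1 hx
          rw [ho]
          have := hmin x h2
          have := hq x h2 h1
          exact sub_pos.2 (lt_of_le_of_ne (by assumption) this.symm))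
      obtain ⟨hyp, hyP⟩ := Finset.mem_erase.1 hy
      refine ⟨p, hp, y, hyP, hyp.symm, fun z hz h1 h2 => ?_⟩
      exact lt_of_le_of_ne (hf z (Finset.mem_erase.2 ⟨h1, hz⟩))
        (h.gp p hp y hyP z hz hyp.symm h1.symm h2.symm).symm
  obtain ⟨x, hx, y, hy, hxy, hh⟩ := edge
  rcases Finset.mem_union.1 hx with hx | hx <;> rcases Finset.mem_union.1 hy with hy | hy
  · exact (h.no_mono hx hy hxy hh).elim
  · exact ⟨x, hx, y, hy, hh⟩
  · rw [Finset.union_comm] at hh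
    obtain ⟨b', hb', -, h1, -⟩ := h.swap.next hx hy hh
    rw [Finset.union_comm] at h1
    exact ⟨y, hy, b', hb', h1⟩
  · rw [Finset.union_comm] at hh
    exact (h.swap.no_mono hx hy hxy hh).elim

theorem Cfg.walk (h : Cfg A S R ρ) : ∃ g b : ℕ → Pt, ∀ i, g i ∈ A ∧ b i ∈ S ∧
    Hull (A ∪ S) (g i) (b i) ∧ Hull (A ∪ S) (b i) (g (i + 1)) ∧ g (i + 1) ≠ g i ∧
    ∀ x ∈ A ∪ S, x ≠ g i → x ≠ g (i + 1) → x ≠ b i → 0 < dt (g i) (g (i + 1)) x := by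
  have step : ∀ st : {x : Pt × Pt // x.1 ∈ A ∧ x.2 ∈ S ∧ Hull (A ∪ S) x.1 x.2},
      ∃ st' : {x : Pt × Pt // x.1 ∈ A ∧ x.2 ∈ S ∧ Hull (A ∪ S) x.1 x.2},
      Hull (A ∪ S) st.1.2 st'.1.1 ∧ st'.1.1 ≠ st.1.1 ∧
      ∀ x ∈ A ∪ S, x ≠ st.1.1 → x ≠ st'.1.1 → x ≠ st.1.2 → 0 < dt st.1.1 st'.1.1 x := by
    rintro ⟨⟨g, b⟩, hg, hb, hh⟩
    obtain ⟨g', hg', hne, h1, h2⟩ := h.next hg hb hh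
    have h1' := h1
    rw [Finset.union_comm] at h1'
    obtain ⟨b', hb', -, h3, -⟩ := h.swap.next hb hg' h1'
    rw [Finset.union_comm] at h3
    exact ⟨⟨⟨g', b'⟩, hg', hb', h3⟩, h1, hne, h2⟩
  choose f hf using step
  obtain ⟨g0, hg0, b0, hb0, hh0⟩ := h.exists_hull
  let st : ℕ → {x : Pt × Pt // x.1 ∈ A ∧ x.2 ∈ S ∧ Hull (A ∪ S) x.1 x.2} :=
    fun i => Nat.rec ⟨⟨g0, b0⟩, hg0, hb0, hh0⟩ (fun _ s => f s) i
  have hst : ∀ i, st (i + 1) = f (st i) := fun i => rfl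
  refine ⟨fun i => (st i).1.1, fun i => (st i).1.2, fun i => ?_⟩
  simp only [hst]
  exact ⟨(st i).2.1, (st i).2.2.1, (st i).2.2.2, (hf (st i)).1, (hf (st i)).2.1, (hf (st i)).2.2⟩

open Classical in
/-- rank of `s` in the sweep at `q`. -/
noncomputable def rk (S : Finset Pt) (q s : Pt) : ℕ := (S.filter (fun x => 0 < dt q x s)).card

theorem dt_self (q x : Pt) : dt q x x = 0 := by unfold dt; ring

theorem rk_lt_card {q s : Pt} (hs : s ∈ S) : rk S q s < S.card := by
  unfold rk
  apply Finset.card_lt_card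
  refine ⟨Finset.filter_subset _ _, fun hh => ?_⟩
  have := hh hs
  simp [dt_self] at this

theorem Cfg.rk_lt (h : Cfg A S R ρ) {q b s s' : Pt} (hq : q ∈ A)
    (hh : Hull (A ∪ S) b q) (hs : s ∈ S) (hs' : s' ∈ S) (hd : 0 < dt q s s') :
    rk S q s < rk S q s' := by
  let o : Pt := fun i => 2 * q i - b i
  have ho : ∀ x, dt q o x = dt b q x := fun x => by simp only [dt, o]; ring
  have hp : ∀ x ∈ S, x ≠ b → 0 < dt q o x := fun x hx hb => by
    rw [ho]; exact hh x (by simp [hx]) hb (h.disj q hq x hx).symm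
  have hn : ∀ x ∈ S, 0 ≤ dt q o x := fun x hx => by
    rcases eq_or_ne x b with rfl | hxb
    · rw [ho]
      unfold dt
      apply le_of_eq; ring
    · exact (hp x hx hxb).le
  have hl : ∀ x ∈ S, ∀ y ∈ S, 0 < dt q x y → x ≠ b := by
    rintro x hx y hy hxy rfl
    have := hn y hy
    rw [ho, dt_swap'] at this
    linarith
  unfold rk
  apply Finset.card_lt_card
  refine ⟨fun x hx => ?_, fun hsub => ?_⟩
  · simp only [Finset.mem_filter] at hx ⊢
    refine ⟨hx.1, dt_trans q o x s s' (hn x hx.1) (hp s hs (hl s hs s' hs' hd)) (hn s' hs')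
      (Or.inl (hp x hx.1 (hl x hx.1 s hs hx.2))) hx.2 hd⟩
  · have : s ∈ S.filter (fun x => 0 < dt q x s) := hsub (by simp [hs, hd])
    simp [dt_self] at this

theorem Cfg.rk_inj (h : Cfg A S R ρ) {q b s s' : Pt} (hq : q ∈ A)
    (hh : Hull (A ∪ S) b q) (hs : s ∈ S) (hs' : s' ∈ S) (e : rk S q s = rk S q s') : s = s' := by
  by_contra hne
  have := h.gp q (by simp [hq]) s (by simp [hs]) s' (by simp [hs']) (h.disj q hq s hs)
    (h.disj q hq s' hs') hne
  rcases lt_or_gt_of_ne this with h1 | h1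
  · have := h.rk_lt hq hh hs' hs (by rw [dt_swap]; linarith)
    omega
  · have := h.rk_lt hq hh hs hs' h1
    omega

theorem perm_rank (S : Finset Pt) (k : Pt → ℕ) (σ : Pt → Pt) (e : Pt) (he : e ∈ S)
    (hk : ∀ s ∈ S, k s < S.card) (hmap : ∀ s ∈ S, σ s ∈ S)
    (hinj : ∀ s ∈ S, ∀ s' ∈ S, σ s = σ s' → s = s')
    (hinc : ∀ s ∈ S, s ≠ e → k s < k (σ s)) :
    (∀ s ∈ S, s ≠ e → k (σ s) = k s + 1) ∧ k e + 1 = S.card ∧ k (σ e) = 0 := by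
  have hinj' : Set.InjOn σ S := fun s hs s' hs' h => hinj s hs s' hs' h
  have hsurj : Set.SurjOn σ S S :=
    Finset.surjOn_of_injOn_of_card_le σ (fun s hs => hmap s hs) hinj' le_rfl
  have hsum : ∑ s ∈ S, k (σ s) = ∑ s ∈ S, k s :=
    Finset.sum_nbij σ hmap hinj' hsurj (fun _ _ => rfl)
  rw [← Finset.add_sum_erase _ _ he, ← Finset.add_sum_erase _ _ he] at hsum
  have hle : ∀ s ∈ S.erase e, k s + 1 ≤ k (σ s) := fun s hs =>
    hinc s (Finset.mem_erase.1 hs).2 (Finset.mem_erase.1 hs).1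
  have h1 := Finset.sum_le_sum hle
  have h2 : ∑ s ∈ S.erase e, (k s + 1) = ∑ s ∈ S.erase e, k s + (S.card - 1) := by
    rw [Finset.sum_add_distrib, Finset.sum_const, Finset.card_erase_of_mem he]; simp
  have h3 := hk e he
  refine ⟨fun s hs hse => ?_, by omega, by omega⟩
  have h4 : ∑ s ∈ S.erase e, (k s + 1) = ∑ s ∈ S.erase e, k (σ s) := by omega
  exact (((Finset.sum_eq_sum_iff_of_le hle).1 h4) s (Finset.mem_erase.2 ⟨hse, hs⟩)).symm

theorem Cfg.struct (h : Cfg A S R ρ) : ∃ g b r : ℕ → Pt, (∀ i, g i ∈ A) ∧ (∀ i, b i ∈ S) ∧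
    (∀ i j, ρ (g i) (b j) = r (i + j)) ∧ (∀ s ∈ S, ∃ j, b j = s) ∧ (∀ a ∈ A, ∃ i, g i = a) ∧
    (∀ r' ∈ R, ∃ k, r (k + 1) = r') ∧
    (3 ≤ S.card → ∀ i, b i ≠ b (i + 1) ∧ b i ≠ b (i + 2)) := by
  obtain ⟨g, b, w⟩ := h.walk
  have hg := fun i => (w i).1
  have hb := fun i => (w i).2.1
  have hH1 := fun i => (w i).2.2.1
  have hH2 := fun i => (w i).2.2.2.1
  have hgg := fun i => (w i).2.2.2.2.1
  have hsk := fun i => (w i).2.2.2.2.2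
  have ex : ∀ i s, ∃ s', s ∈ S → s' ∈ S ∧ ρ (g i) s' = ρ (g (i + 1)) s := by
    intro i s
    by_cases hs : s ∈ S
    · obtain ⟨s', h1, h2⟩ := h.surjS (g i) (hg i) (ρ (g (i + 1)) s) (h.mem _ (hg _) s hs)
      exact ⟨s', fun _ => ⟨h1, h2⟩⟩
    · exact ⟨s, fun hh => absurd hh hs⟩
  choose σ hσ using ex
  have hmap : ∀ i, ∀ s ∈ S, σ i s ∈ S := fun i s hs => (hσ i s hs).1
  have hρ : ∀ i, ∀ s ∈ S, ρ (g i) (σ i s) = ρ (g (i + 1)) s := fun i s hs => (hσ i s hs).2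
  have hinj : ∀ i, ∀ s ∈ S, ∀ s' ∈ S, σ i s = σ i s' → s = s' := by
    intro i s hs s' hs' e
    apply h.injS (g (i + 1)) (hg _) s hs s' hs'
    rw [← hρ i s hs, ← hρ i s' hs', e]
  have hA : ∀ i, (∀ s ∈ S, s ≠ b i → rk S (g (i + 1)) (σ i s) = rk S (g (i + 1)) s + 1) ∧
      rk S (g (i + 1)) (b i) + 1 = S.card ∧ rk S (g (i + 1)) (σ i (b i)) = 0 := by
    intro i
    apply perm_rank S _ (σ i) (b i) (hb i) (fun s hs => rk_lt_card hs) (hmap i) (hinj i)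
    intro s hs hsb
    apply h.rk_lt (hg _) (hH2 i) hs (hmap i s hs)
    have sd := h.side (hg (i + 1)) (hg i) hs (hmap i s hs) (hgg i) (hρ i s hs).symm
    refine (pos_iff_pos_of_mul_pos sd).1 ?_
    rw [← dt_rot]
    exact hsk i s (by simp [hs]) (h.disj _ (hg i) s hs).symm (h.disj _ (hg _) s hs).symm hsb
  have hB : ∀ i, ∃ e ∈ S, (∀ s ∈ S, s ≠ e →
      rk S (g (i + 1)) (σ (i + 1) s) = rk S (g (i + 1)) s + 1) ∧
      rk S (g (i + 1)) e + 1 = S.card ∧ rk S (g (i + 1)) (σ (i + 1) e) = 0 := by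
    intro i
    obtain ⟨e, he, hee⟩ : ∃ e ∈ S, σ (i + 1) e = b (i + 1) :=
      Finset.surjOn_of_injOn_of_card_le (σ (i + 1)) (fun s hs => hmap _ s hs)
        (fun s hs s' hs' h => hinj _ s hs s' hs' h) le_rfl (hb (i + 1))
    refine ⟨e, he, ?_⟩
    apply perm_rank S _ (σ (i + 1)) e he (fun s hs => rk_lt_card hs) (hmap _) (hinj _)
    intro s hs hse
    have hs' := hmap (i + 1) s hs
    apply h.rk_lt (hg _) (hH2 i) hs hs'
    have sd := h.side (hg (i + 1)) (hg (i + 2)) hs' hs (hgg (i + 1)).symm (hρ (i + 1) s hs)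
    have hne : σ (i + 1) s ≠ b (i + 1) := fun hc =>
      hse (hinj _ s hs e he (hc.trans hee.symm))
    have := hsk (i + 1) _ (by simp [hs']) (h.disj _ (hg (i + 1)) _ hs').symm
      (h.disj _ (hg (i + 2)) _ hs').symm hne
    rw [dt_swap, dt_swap _ _ s, neg_mul_neg] at sd
    exact (pos_iff_pos_of_mul_pos sd).1 this
  have hb0 : ∀ i, rk S (g (i + 1)) (b (i + 1)) = 0 := by
    intro i
    unfold rk
    rw [Finset.card_eq_zero, Finset.filter_eq_empty_iff]
    intro x hx hpos
    rcases eq_or_ne x (b (i + 1)) with rfl | hne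
    · rw [dt_self] at hpos; exact lt_irrefl _ hpos
    · have := hH1 (i + 1) x (by simp [hx]) (h.disj _ (hg _) x hx).symm hne
      rw [dt_swap] at this
      linarith
  have hσb : ∀ i, σ i (b i) = b (i + 1) := fun i =>
    h.rk_inj (hg _) (hH2 i) (hmap i _ (hb i)) (hb _) ((hA i).2.2.trans (hb0 i).symm)
  have hσσ : ∀ i, ∀ s ∈ S, σ (i + 1) s = σ i s := by
    intro i s hs
    obtain ⟨e, he, h1, h2, h3⟩ := hB i
    obtain ⟨h4, h5, h6⟩ := hA i
    have hee : e = b i := h.rk_inj (hg _) (hH2 i) he (hb i) (by omega)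
    subst hee
    apply h.rk_inj (hg _) (hH2 i) (hmap _ s hs) (hmap _ s hs)
    rcases eq_or_ne s (b i) with rfl | hne
    · rw [h3, h6]
    · rw [h1 s hs hne, h4 s hs hne]
  have hσ0 : ∀ i, ∀ s ∈ S, σ i s = σ 0 s := by
    intro i s hs
    induction i with
    | zero => rfl
    | succ i ih => rw [hσσ i s hs, ih]
  have hbs : ∀ i j, σ i (b j) = b (j + 1) := fun i j => by
    rw [hσ0 i _ (hb j), ← hσ0 j _ (hb j), hσb]
  have hstep : ∀ i j, ρ (g (i + 1)) (b j) = ρ (g i) (b (j + 1)) := fun i j => by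
    rw [← hbs i j, hρ i _ (hb j)]
  have hall : ∀ i j, ρ (g i) (b j) = ρ (g 0) (b (i + j)) := by
    intro i
    induction i with
    | zero => intro j; simp
    | succ i ih => intro j; rw [hstep, ih]; congr 2; omega
  -- ranks of the points b
  have hrk : ∀ m, m < S.card → rk S (g 1) (b (m + 1)) = m := by
    intro m
    induction m with
    | zero => intro _; exact hb0 0
    | succ m ih =>
      intro hm
      have h1 := ih (by omega)
      obtain ⟨h4, h5, h6⟩ := hA 0
      rw [← hbs 0 (m + 1)]
      rw [h4 _ (hb _) (fun hc => by rw [hc] at h1; simp only [zero_add] at h5; omega)]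
      simp only [zero_add]
      omega
  have hbinj : ∀ m m', m < S.card → m' < S.card → b (m + 1) = b (m' + 1) → m = m' := by
    intro m m' h1 h2 e
    rw [← hrk m h1, ← hrk m' h2, e]
  have hcov : ∀ s ∈ S, ∃ j, b (j + 1) = s := by
    intro s hs
    obtain ⟨j, _, hj⟩ := Finset.surj_on_of_inj_on_of_card_le (s := Finset.range S.card) (t := S)
      (fun m _ => b (m + 1)) (fun m _ => hb _)
      (fun m m' h1 h2 e => hbinj m m' (Finset.mem_range.1 h1) (Finset.mem_range.1 h2) e)
      (by simp) s hs
    exact ⟨j, hj.symm⟩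
  refine ⟨g, b, fun k => ρ (g 0) (b k), hg, hb, hall, fun s hs => ?_, fun a ha => ?_, fun r' hr => ?_,
    fun hn i => ?_⟩
  · obtain ⟨j, hj⟩ := hcov s hs
    exact ⟨_, hj⟩
  · obtain ⟨j, _, hj⟩ := Finset.surj_on_of_inj_on_of_card_le (s := Finset.range S.card) (t := A)
      (fun m _ => g m) (fun m _ => hg _)
      (fun m m' h1 h2 e => by
        apply hbinj m m' (Finset.mem_range.1 h1) (Finset.mem_range.1 h2)
        have e1 := hall m 1
        have e2 := hall m' 1
        have e' : g m = g m' := e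
        rw [e', e2] at e1
        exact (h.injS _ (hg 0) _ (hb _) _ (hb _) e1).symm)
      (by simp [h.cardEq]) a ha
    exact ⟨j, hj.symm⟩
  · obtain ⟨s, hs, e⟩ := h.surjS _ (hg 0) r' hr
    obtain ⟨j, hj⟩ := hcov s hs
    exact ⟨j, by simp only [hj, e]⟩
  · obtain ⟨h4, h5, h6⟩ := hA i
    have h7 := hb0 i
    have h8 : rk S (g (i + 1)) (b (i + 2)) = 1 := by
      rw [← hbs i (i + 1), h4 _ (hb _) (fun hc => by rw [hc] at h7; omega), h7]
    constructor
    · intro hc; rw [hc] at h5; omega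
    · intro hc; rw [hc] at h5; omega

end
/-- Polynomial functions of degree at most `d` on the plane. -/
def PF : ℕ → (Pt → ℝ) → Prop
  | 0, f => ∃ c : ℝ, ∀ p, f p = c
  | d + 1, f => ∃ q1 q2 : Pt → ℝ, ∃ c : ℝ, PF d q1 ∧ PF d q2 ∧
      ∀ p, f p = p 0 * q1 p + p 1 * q2 p + c

theorem PF.const (d : ℕ) (c : ℝ) : PF d (fun _ => c) := by
  induction d generalizing c with
  | zero => exact ⟨c, fun _ => rfl⟩
  | succ d ih => exact ⟨_, _, c, ih 0, ih 0, fun p => by ring⟩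

theorem PF.congr {d : ℕ} {f g : Pt → ℝ} (h : PF d f) (e : ∀ p, g p = f p) : PF d g := by
  have : g = f := funext e
  rwa [this]

theorem PF.add {d : ℕ} {f g : Pt → ℝ} (hf : PF d f) (hg : PF d g) : PF d (fun p => f p + g p) := by
  induction d generalizing f g with
  | zero =>
    obtain ⟨c, hc⟩ := hf
    obtain ⟨c', hc'⟩ := hg
    exact ⟨c + c', fun p => by simp only [hc, hc']⟩
  | succ d ih =>
    obtain ⟨q1, q2, c, h1, h2, e⟩ := hf
    obtain ⟨q1', q2', c', h1', h2', e'⟩ := hg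
    exact ⟨_, _, c + c', ih h1 h1', ih h2 h2', fun p => by simp only [e, e']; ring⟩

theorem PF.smul {d : ℕ} {f : Pt → ℝ} (k : ℝ) (hf : PF d f) : PF d (fun p => k * f p) := by
  induction d generalizing f with
  | zero =>
    obtain ⟨c, hc⟩ := hf
    exact ⟨k * c, fun p => by simp only [hc]⟩
  | succ d ih =>
    obtain ⟨q1, q2, c, h1, h2, e⟩ := hf
    exact ⟨_, _, k * c, ih h1, ih h2, fun p => by simp only [e]; ring⟩

theorem PF.succ {d : ℕ} {f : Pt → ℝ} (hf : PF d f) : PF (d + 1) f := by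
  induction d generalizing f with
  | zero =>
    obtain ⟨c, hc⟩ := hf
    exact (PF.const 1 c).congr hc
  | succ d ih =>
    obtain ⟨q1, q2, c, h1, h2, e⟩ := hf
    exact ⟨q1, q2, c, ih h1, ih h2, e⟩

theorem PF.mono {d e : ℕ} {f : Pt → ℝ} (hf : PF d f) (h : d ≤ e) : PF e f := by
  induction h with
  | refl => exact hf
  | step _ ih => exact ih.succ

theorem PF.mul0 {d : ℕ} {f : Pt → ℝ} (hf : PF d f) : PF (d + 1) (fun p => p 0 * f p) :=
  ⟨f, _, 0, hf, PF.const d 0, fun p => by ring⟩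

theorem PF.mul1 {d : ℕ} {f : Pt → ℝ} (hf : PF d f) : PF (d + 1) (fun p => p 1 * f p) :=
  ⟨_, f, 0, PF.const d 0, hf, fun p => by ring⟩

theorem PF.mul_aff {d : ℕ} {f l : Pt → ℝ} (α β γ : ℝ) (hl : ∀ p, l p = α * p 0 + β * p 1 + γ)
    (hf : PF d f) : PF (d + 1) (fun p => l p * f p) :=
  (((hf.mul0.smul α).add (hf.mul1.smul β)).add (hf.succ.smul γ)).congr
    fun p => by rw [hl]; ring

theorem PF.mul_dt {d : ℕ} {f : Pt → ℝ} (a b : Pt) (hf : PF d f) :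
    PF (d + 1) (fun p => dt a b p * f p) :=
  PF.mul_aff (-(b 1 - a 1)) (b 0 - a 0) (-(b 0 - a 0) * a 1 + (b 1 - a 1) * a 0)
    (fun p => by unfold dt; ring) hf

theorem PF.sum {ι : Type*} {d : ℕ} (T : Finset ι) (f : ι → Pt → ℝ) (h : ∀ i ∈ T, PF d (f i)) :
    PF d (fun p => ∑ i ∈ T, f i p) := by
  classical
  induction T using Finset.induction_on with
  | empty => simpa using PF.const d 0
  | insert a T ha ih =>
    have h1 := h a (by simp)
    have h2 := ih (fun i hi => h i (by simp [hi]))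
    exact (h1.add h2).congr fun p => by rw [Finset.sum_insert ha]

theorem PF.poly {l : Pt → ℝ} (α β γ : ℝ) (hl : ∀ p, l p = α * p 0 + β * p 1 + γ)
    (d : ℕ) (h : Polynomial ℝ) (hd : h.natDegree ≤ d) : PF d (fun p => h.eval (l p)) := by
  have hpow : ∀ k, PF k (fun p => l p ^ k) := by
    intro k
    induction k with
    | zero => simpa using PF.const 0 1
    | succ k ih => exact (PF.mul_aff α β γ hl ih).congr fun p => by ring
  refine (PF.sum (Finset.range (d + 1)) (fun k p => h.coeff k * l p ^ k) (fun k hk => ?_)).congr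
    fun p => Polynomial.eval_eq_sum_range' (by omega) _
  exact ((hpow k).smul _).mono (by have := Finset.mem_range.1 hk; omega)

noncomputable def mm (a b p : Pt) : ℝ :=
  ((b 0 - a 0) * (p 0 - a 0) + (b 1 - a 1) * (p 1 - a 1)) / nrm a b

theorem mm_aff (a b p : Pt) : mm a b p = ((b 0 - a 0) / nrm a b) * p 0 + ((b 1 - a 1) / nrm a b) * p 1
    + (-((b 0 - a 0) * a 0 + (b 1 - a 1) * a 1) / nrm a b) := by unfold mm; ring

theorem coord0 (a b p : Pt) (hN : 0 < nrm a b) :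
    p 0 = a 0 + (b 0 - a 0) * mm a b p + (-(b 1 - a 1) / nrm a b) * dt a b p := by
  have h := hN.ne'
  unfold mm; field_simp
  unfold dt nrm; ring

theorem coord1 (a b p : Pt) (hN : 0 < nrm a b) :
    p 1 = a 1 + (b 1 - a 1) * mm a b p + ((b 0 - a 0) / nrm a b) * dt a b p := by
  have h := hN.ne'
  unfold mm; field_simp
  unfold dt nrm; ring

open Polynomial in
theorem PF.decomp (a b : Pt) (hN : 0 < nrm a b) (d : ℕ) (f : Pt → ℝ) (hf : PF (d + 1) f) :
    ∃ q : Pt → ℝ, ∃ h : ℝ[X], PF d q ∧ h.natDegree ≤ d + 1 ∧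
      ∀ p, f p = dt a b p * q p + h.eval (mm a b p) := by
  induction d generalizing f with
  | zero =>
    obtain ⟨q1, q2, c, ⟨c1, h1⟩, ⟨c2, h2⟩, e⟩ := hf
    refine ⟨fun _ => (-(b 1 - a 1) / nrm a b) * c1 + ((b 0 - a 0) / nrm a b) * c2,
      C (a 0 * c1 + a 1 * c2 + c) + C ((b 0 - a 0) * c1 + (b 1 - a 1) * c2) * X, PF.const _ _,
      by compute_degree, fun p => ?_⟩
    rw [e, h1, h2]
    simp only [eval_add, eval_mul, eval_C, eval_X]
    linear_combination c1 * coord0 a b p hN + c2 * coord1 a b p hN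
  | succ d ih =>
    obtain ⟨q1, q2, c, h1, h2, e⟩ := hf
    obtain ⟨u1, k1, hu1, hk1, e1⟩ := ih q1 h1
    obtain ⟨u2, k2, hu2, hk2, e2⟩ := ih q2 h2
    refine ⟨fun p => (p 0 * u1 p + (-(b 1 - a 1) / nrm a b) * k1.eval (mm a b p)) +
        (p 1 * u2 p + ((b 0 - a 0) / nrm a b) * k2.eval (mm a b p)),
      (C (a 0) + C (b 0 - a 0) * X) * k1 + (C (a 1) + C (b 1 - a 1) * X) * k2 + C c, ?_, ?_, ?_⟩
    · exact (hu1.mul0.add ((PF.poly _ _ _ (mm_aff a b) _ k1 hk1).smul _)).add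
        (hu2.mul1.add ((PF.poly _ _ _ (mm_aff a b) _ k2 hk2).smul _))
    · have hl : ∀ x y : ℝ, (C x + C y * X : ℝ[X]).natDegree ≤ 1 := fun x y => by compute_degree
      refine natDegree_add_le_of_degree_le (natDegree_add_le_of_degree_le ?_ ?_) (by simp)
      · exact (natDegree_mul_le_of_le (hl _ _) hk1).trans (by omega)
      · exact (natDegree_mul_le_of_le (hl _ _) hk2).trans (by omega)
    · intro p
      rw [e, e1, e2]
      simp only [eval_add, eval_mul, eval_C, eval_X]
      linear_combination (k1.eval (mm a b p)) * coord0 a b p hN +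
        (k2.eval (mm a b p)) * coord1 a b p hN

theorem PF.div (a b : Pt) (hN : 0 < nrm a b) (d : ℕ) (f : Pt → ℝ) (hf : PF (d + 1) f)
    (T : Finset Pt) (hT : d + 2 ≤ T.card) (hl : ∀ p ∈ T, dt a b p = 0) (h0 : ∀ p ∈ T, f p = 0) :
    ∃ q : Pt → ℝ, PF d q ∧ ∀ p, f p = dt a b p * q p := by
  obtain ⟨q, h, hq, hd, e⟩ := PF.decomp a b hN d f hf
  refine ⟨q, hq, ?_⟩
  have hinj : Set.InjOn (mm a b) T := by
    intro x hx y hy hxy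
    have := coord0 a b x hN
    have := coord1 a b x hN
    have := coord0 a b y hN
    have := coord1 a b y hN
    rw [hl x hx] at *
    rw [hl y hy] at *
    funext i; fin_cases i
    · simp only [Fin.zero_eta]; simp_all
    · simp only [Fin.mk_one]; simp_all
  have hz : h = 0 := by
    refine Polynomial.eq_zero_of_natDegree_lt_card_of_eval_eq_zero' h (T.image (mm a b)) ?_ ?_
    · intro y hy
      obtain ⟨x, hx, rfl⟩ := Finset.mem_image.1 hy
      have := e x
      rw [h0 x hx, hl x hx] at this
      linarith
    · rw [Finset.card_image_of_injOn hinj]; omega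
  intro p
  rw [e, hz]; simp

theorem nrm_pos {a b : Pt} (h : a ≠ b) : 0 < nrm a b := by
  unfold nrm
  by_contra hh
  apply h
  have h0 : b 0 - a 0 = 0 := by nlinarith [sq_nonneg (b 0 - a 0), sq_nonneg (b 1 - a 1)]
  have h1 : b 1 - a 1 = 0 := by nlinarith [sq_nonneg (b 0 - a 0), sq_nonneg (b 1 - a 1)]
  funext i; fin_cases i
  · simp only [Fin.zero_eta]; linarith
  · simp only [Fin.mk_one]; linarith

theorem chasles (f : Pt → ℝ) (hf : PF 3 f)
    (p11 p12 p13 p21 p22 p23 p31 p32 p33 : Pt)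
    (r1 : dt p11 p12 p13 = 0) (r2 : dt p21 p22 p23 = 0) (r3 : dt p31 p32 p33 = 0)
    (c1 : dt p11 p21 p31 = 0) (c2 : dt p12 p22 p32 = 0) (c3 : dt p13 p23 p33 = 0)
    (d12 : p11 ≠ p12) (d13 : p11 ≠ p13) (d23 : p12 ≠ p13)
    (e12 : p21 ≠ p22) (e13 : p21 ≠ p23) (e23 : p22 ≠ p23) (g12 : p31 ≠ p32)
    (n21 : dt p11 p12 p21 ≠ 0) (n22 : dt p11 p12 p22 ≠ 0) (n23 : dt p11 p12 p23 ≠ 0)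
    (n31 : dt p11 p12 p31 ≠ 0) (n32 : dt p11 p12 p32 ≠ 0)
    (m31 : dt p21 p22 p31 ≠ 0) (m32 : dt p21 p22 p32 ≠ 0)
    (k1 : dt p11 p21 p12 ≠ 0) (k2 : dt p12 p22 p11 ≠ 0) (k3 : dt p13 p23 p11 ≠ 0)
    (f11 : f p11 = 0) (f12 : f p12 = 0) (f13 : f p13 = 0)
    (f21 : f p21 = 0) (f22 : f p22 = 0) (f23 : f p23 = 0)
    (f31 : f p31 = 0) (f32 : f p32 = 0) : f p33 = 0 := by
  let M : Pt → ℝ := fun p => dt p11 p21 p * (dt p12 p22 p * (dt p13 p23 p * 1))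
  have hM : PF 3 M := (((PF.const 0 1).mul_dt p13 p23).mul_dt p12 p22).mul_dt p11 p21
  have z : ∀ a b : Pt, dt a b a = 0 ∧ dt a b b = 0 := fun a b => by
    constructor <;> (unfold dt; ring)
  have M11 : M p11 = 0 := by simp [M, z]
  have M12 : M p12 = 0 := by simp [M, z]
  have M13 : M p13 = 0 := by simp [M, z]
  have M21 : M p21 = 0 := by simp [M, z]
  have M22 : M p22 = 0 := by simp [M, z]
  have M23 : M p23 = 0 := by simp [M, z]
  have M31 : M p31 = 0 := by simp [M, c1]
  have M32 : M p32 = 0 := by simp [M, c2]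
  have M33 : M p33 = 0 := by simp [M, c3]
  obtain ⟨w, hw, hMw⟩ : ∃ w, dt p11 p12 w = 0 ∧ M w ≠ 0 := by
    let W : ℝ → Pt := fun t i => p11 i + t * (p12 i - p11 i)
    have hW : ∀ a b t, dt a b (W t) = (1 - t) * dt a b p11 + t * dt a b p12 := fun a b t => by
      simp only [dt, W]; ring
    have hWl : ∀ t, dt p11 p12 (W t) = 0 := fun t => by rw [hW]; simp [z]
    have key : ∀ t : ℝ, t ≠ 0 → t ≠ 1 → dt p13 p23 (W t) ≠ 0 → M (W t) ≠ 0 := by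
      intro t h0 h1 h3
      simp only [M]
      refine mul_ne_zero ?_ (mul_ne_zero ?_ (mul_ne_zero h3 one_ne_zero))
      · rw [hW, (z p11 p21).1, mul_zero, zero_add]; exact mul_ne_zero h0 k1
      · rw [hW, (z p12 p22).1, mul_zero, add_zero]
        exact mul_ne_zero (sub_ne_zero.2 h1.symm) k2
    by_cases h2 : dt p13 p23 (W 2) = 0
    · refine ⟨W 3, hWl 3, key 3 (by norm_num) (by norm_num) fun h3 => k3 ?_⟩
      rw [hW] at h2 h3
      linarith
    · exact ⟨W 2, hWl 2, key 2 (by norm_num) (by norm_num) h2⟩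
  let F : Pt → ℝ := fun p => f p + (-(f w / M w)) * M p
  have hF : PF 3 F := hf.add (hM.smul _)
  have hFw : F w = 0 := by simp only [F]; field_simp; ring
  have dw : ∀ p, M p = 0 → p ≠ w := by rintro p hp rfl; exact hMw hp
  obtain ⟨Q, hQ, eQ⟩ := PF.div p11 p12 (nrm_pos d12) 2 F hF {p11, p12, p13, w}
    (by rw [Finset.card_insert_of_notMem, Finset.card_insert_of_notMem,
          Finset.card_insert_of_notMem, Finset.card_singleton] <;>
        simp [d12, d13, d23, dw _ M11, dw _ M12, dw _ M13])
    (by simp [z, r1, hw])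
    (by
      intro p hp
      simp only [Finset.mem_insert, Finset.mem_singleton] at hp
      rcases hp with rfl | rfl | rfl | rfl
      · simp [F, f11, M11]
      · simp [F, f12, M12]
      · simp [F, f13, M13]
      · exact hFw)
  have Q0 : ∀ p, f p = 0 → M p = 0 → dt p11 p12 p ≠ 0 → Q p = 0 := by
    intro p h1 h2 h3
    have := eQ p
    simp only [F, h1, h2] at this
    have h4 : dt p11 p12 p * Q p = 0 := by linarith
    exact (mul_eq_zero.1 h4).resolve_left h3
  obtain ⟨K, hK, eK⟩ := PF.div p21 p22 (nrm_pos e12) 1 Q hQ {p21, p22, p23}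
    (by rw [Finset.card_insert_of_notMem, Finset.card_insert_of_notMem,
          Finset.card_singleton] <;> simp [e12, e13, e23])
    (by simp [z, r2])
    (by
      intro p hp
      simp only [Finset.mem_insert, Finset.mem_singleton] at hp
      rcases hp with rfl | rfl | rfl
      · exact Q0 _ f21 M21 n21
      · exact Q0 _ f22 M22 n22
      · exact Q0 _ f23 M23 n23)
  have K0 : ∀ p, Q p = 0 → dt p21 p22 p ≠ 0 → K p = 0 := by
    intro p h1 h3
    have := eK p
    rw [h1] at this
    exact (mul_eq_zero.1 this.symm).resolve_left h3
  obtain ⟨c, hc, ec⟩ := PF.div p31 p32 (nrm_pos g12) 0 K hK {p31, p32}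
    (by rw [Finset.card_insert_of_notMem, Finset.card_singleton]; simp [g12])
    (by simp [z])
    (by
      intro p hp
      simp only [Finset.mem_insert, Finset.mem_singleton] at hp
      rcases hp with rfl | rfl
      · exact K0 _ (Q0 _ f31 M31 n31) m31
      · exact K0 _ (Q0 _ f32 M32 n32) m32)
  have h1 := eQ p33
  rw [eK, ec, r3] at h1
  simp only [F, M33] at h1
  linarith

/-- a nonzero cubic through nine points -/
theorem exists_cubic (T : Finset Pt) (hT : T.card ≤ 9) :
    ∃ f : MvPolynomial (Fin 2) ℝ, f ≠ 0 ∧ f.totalDegree ≤ 3 ∧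
      PF 3 (fun p => MvPolynomial.eval p f) ∧ ∀ p ∈ T, MvPolynomial.eval p f = 0 := by
  classical
  let I : Finset (ℕ × ℕ) := (Finset.range 4 ×ˢ Finset.range 4).filter (fun x => x.1 + x.2 ≤ 3)
  have hI : I.card = 10 := by decide
  have hmem : ∀ x ∈ I, x.1 + x.2 ≤ 3 := fun x hx => (Finset.mem_filter.1 hx).2
  let e : ℕ × ℕ → (Fin 2 →₀ ℕ) := fun x => Finsupp.single 0 x.1 + Finsupp.single 1 x.2
  have he0 : ∀ x, e x 0 = x.1 := fun x => by simp [e]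
  have he1 : ∀ x, e x 1 = x.2 := fun x => by simp [e]
  have hinj : Function.Injective e := by
    intro x y h
    ext
    · rw [← he0, h, he0]
    · rw [← he1, h, he1]
  let L : (I → ℝ) →ₗ[ℝ] (T → ℝ) :=
    { toFun := fun c t => ∑ x : I, c x * (t.1 0 ^ x.1.1 * t.1 1 ^ x.1.2)
      map_add' := fun c c' => by
        funext t; simp [add_mul, Finset.sum_add_distrib]
      map_smul' := fun k c => by
        funext t; simp [Finset.mul_sum, mul_assoc] }
  obtain ⟨c, hc, hc0⟩ : ∃ c ∈ LinearMap.ker L, c ≠ 0 := by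
    apply Submodule.exists_mem_ne_zero_of_ne_bot
    apply LinearMap.ker_ne_bot_of_finrank_lt
    simp only [Module.finrank_fintype_fun_eq_card, Fintype.card_coe]
    omega
  let f : MvPolynomial (Fin 2) ℝ := ∑ x : I, MvPolynomial.monomial (e x.1) (c x)
  have hev : ∀ p, MvPolynomial.eval p f = ∑ x : I, c x * (p 0 ^ x.1.1 * p 1 ^ x.1.2) := by
    intro p
    simp only [f, map_sum, MvPolynomial.eval_monomial]
    refine Finset.sum_congr rfl fun x _ => ?_
    rw [Finsupp.prod_fintype _ _ (fun i => pow_zero _), Fin.prod_univ_two, he0, he1]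
  refine ⟨f, ?_, ?_, ?_, ?_⟩
  · intro hf
    apply hc0
    funext x
    have := congrArg (MvPolynomial.coeff (e x.1)) hf
    simp only [f, MvPolynomial.coeff_sum, MvPolynomial.coeff_monomial, MvPolynomial.coeff_zero] at this
    rw [Finset.sum_eq_single x] at this
    · simpa using this
    · intro y _ hy
      rw [if_neg]
      intro h
      exact hy (Subtype.ext (hinj h))
    · simp
  · refine MvPolynomial.totalDegree_finsetSum_le fun x _ => ?_
    refine (MvPolynomial.totalDegree_monomial_le _ _).trans ?_
    rw [Finsupp.sum_fintype _ _ (fun i => rfl), Fin.sum_univ_two, he0, he1]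
    exact hmem x.1 x.2
  · refine PF.congr (PF.sum Finset.univ (fun (x : I) p => c x * (p 0 ^ x.1.1 * p 1 ^ x.1.2))
      fun x _ => ?_) hev
    have hy : ∀ j, PF j (fun p => p 1 ^ j) := by
      intro j
      induction j with
      | zero => simpa using PF.const 0 1
      | succ j ih => exact ih.mul1.congr fun p => by ring
    have hxy : ∀ i j, PF (j + i) (fun p => p 0 ^ i * p 1 ^ j) := by
      intro i j
      induction i with
      | zero => simpa using hy j
      | succ i ih => exact ih.mul0.congr fun p => by ring
    exact ((hxy x.1.1 x.1.2).smul _).mono (by have := hmem x.1 x.2; omega)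
  · intro p hp
    rw [hev]
    have := congrFun (LinearMap.mem_ker.1 hc) ⟨p, hp⟩
    exact this
section
variable {A S R : Finset Pt} {ρ : Pt → Pt → Pt}

theorem Cfg.line_ne (h : Cfg A S R ρ) {a s} (ha : a ∈ A) (hs : s ∈ S) :
    ∃ t : ℝ, t ≠ 0 ∧ t ≠ 1 ∧ ∀ i, ρ a s i = a i + t * (s i - a i) := by
  obtain ⟨t, ht, e⟩ := h.line a ha s hs
  refine ⟨t, ?_, ?_, e⟩
  · rintro rfl; simp at ht
  · rintro rfl; simp at ht

theorem Cfg.on_line (h : Cfg A S R ρ) {a s r} (ha : a ∈ A) (hs : s ∈ S) (hr : r ∈ R)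
    (hne : r ≠ ρ a s) : dt a s r ≠ 0 := by
  obtain ⟨s', hs', rfl⟩ := h.surjS a ha r hr
  have hss : s ≠ s' := fun e => hne (by rw [e])
  obtain ⟨t, t0, -, e⟩ := h.line_ne ha hs'
  have : dt a s (ρ a s') = t * dt a s s' := by
    unfold dt; rw [e, e]; ring
  rw [this]
  exact mul_ne_zero t0 (h.gp a (by simp [ha]) s (by simp [hs]) s' (by simp [hs'])
    (h.disj a ha s hs) (h.disj a ha s' hs') hss)

theorem Cfg.off (h : Cfg A S R ρ) {a s x} (ha : a ∈ A) (hs : s ∈ S)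
    (hx : (x ∈ A ∧ x ≠ a) ∨ (x ∈ S ∧ x ≠ s) ∨ (x ∈ R ∧ x ≠ ρ a s)) : dt a s x ≠ 0 := by
  have has := h.disj a ha s hs
  rcases hx with ⟨hx, hn⟩ | ⟨hx, hn⟩ | ⟨hx, hn⟩
  · exact h.gp a (by simp [ha]) s (by simp [hs]) x (by simp [hx]) has hn.symm (h.disj x hx s hs).symm
  · exact h.gp a (by simp [ha]) s (by simp [hs]) x (by simp [hx]) has (h.disj a ha x hx) hn.symm
  · exact h.on_line ha hs hx hn

theorem Cfg.pairs (h : Cfg A S R ρ) {a s x u v} (ha : a ∈ A) (hs : s ∈ S)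
    (hu : u = a ∨ u = s ∨ u = ρ a s) (hv : v = a ∨ v = s ∨ v = ρ a s) (huv : u ≠ v)
    (hx : dt a s x ≠ 0) : dt u v x ≠ 0 := by
  obtain ⟨t, t0, t1, e⟩ := h.line_ne ha hs
  have t1' : t - 1 ≠ 0 := sub_ne_zero.2 t1
  have e1 : dt s a x = (-1) * dt a s x := by unfold dt; ring
  have e2 : dt a (ρ a s) x = t * dt a s x := by unfold dt; rw [e, e]; ring
  have e3 : dt (ρ a s) a x = (-t) * dt a s x := by unfold dt; rw [e, e]; ring
  have e4 : dt s (ρ a s) x = (t - 1) * dt a s x := by unfold dt; rw [e, e]; ring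
  have e5 : dt (ρ a s) s x = (-(t - 1)) * dt a s x := by unfold dt; rw [e, e]; ring
  rcases hu with rfl | rfl | rfl <;> rcases hv with rfl | rfl | rfl
  · exact absurd rfl huv
  · exact hx
  · rw [e2]; exact mul_ne_zero t0 hx
  · rw [e1]; exact mul_ne_zero (by norm_num) hx
  · exact absurd rfl huv
  · rw [e4]; exact mul_ne_zero t1' hx
  · rw [e3]; exact mul_ne_zero (neg_ne_zero.2 t0) hx
  · rw [e5]; exact mul_ne_zero (neg_ne_zero.2 t1') hx
  · exact absurd rfl huv

theorem Cfg.triple (h : Cfg A S R ρ) {a s u v w} (ha : a ∈ A) (hs : s ∈ S)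
    (hu : u = a ∨ u = s ∨ u = ρ a s) (hv : v = a ∨ v = s ∨ v = ρ a s)
    (hw : w = a ∨ w = s ∨ w = ρ a s) : dt u v w = 0 := by
  obtain ⟨t, t0, t1, e⟩ := h.line_ne ha hs
  rcases hu with rfl | rfl | rfl <;> rcases hv with rfl | rfl | rfl <;>
    rcases hw with rfl | rfl | rfl <;> (unfold dt; (try rw [e, e]); ring)

/-- Rows of a 3 by 3 array are collinear, and different rows do not meet in the array. -/
structure HalfGrid (p : Fin 3 → Fin 3 → Pt) : Prop where
  col : ∀ i j k l, dt (p i j) (p i k) (p i l) = 0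
  off : ∀ i i' j k l, i ≠ i' → j ≠ k → dt (p i j) (p i k) (p i' l) ≠ 0

theorem Cfg.halfGrid (h : Cfg A S R ρ) (p : Fin 3 → Fin 3 → Pt) (a s : Fin 3 → Pt)
    (ha : ∀ i, a i ∈ A) (hs : ∀ i, s i ∈ S)
    (hp : ∀ i j, p i j = a i ∨ p i j = s i ∨ p i j = ρ (a i) (s i))
    (hne : ∀ i j k, j ≠ k → p i j ≠ p i k)
    (haa : ∀ i j, i ≠ j → a j ≠ a i) (hss : ∀ i j, i ≠ j → s j ≠ s i)
    (hrr : ∀ i j, i ≠ j → ρ (a j) (s j) ≠ ρ (a i) (s i)) : HalfGrid p where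
  col := fun i j k l => h.triple (ha i) (hs i) (hp i j) (hp i k) (hp i l)
  off := by
    intro i i' j k l hi hj
    refine h.pairs (ha i) (hs i) (hp i j) (hp i k) (hne i j k hj) (h.off (ha i) (hs i) ?_)
    rcases hp i' l with e | e | e
    · exact Or.inl ⟨e ▸ ha i', e ▸ haa i i' hi⟩
    · exact Or.inr (Or.inl ⟨e ▸ hs i', e ▸ hss i i' hi⟩)
    · exact Or.inr (Or.inr ⟨e ▸ h.mem _ (ha i') _ (hs i'), e ▸ hrr i i' hi⟩)

theorem HalfGrid.ne {p : Fin 3 → Fin 3 → Pt} (h : HalfGrid p) (i j k : Fin 3) (hjk : j ≠ k) :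
    p i j ≠ p i k := by
  intro e
  apply h.off i (i + 1) j k 0 (by fin_cases i <;> decide) hjk
  rw [e]; unfold dt; ring

theorem HalfGrid.perm {p : Fin 3 → Fin 3 → Pt} (h : HalfGrid p) (σ τ : Equiv.Perm (Fin 3)) :
    HalfGrid (fun i j => p (σ i) (τ j)) where
  col := fun _ _ _ _ => h.col _ _ _ _
  off := fun i i' j k l h1 h2 => h.off _ _ _ _ _ (fun e => h1 (σ.injective e))
    (fun e => h2 (τ.injective e))

theorem grid_last {f : Pt → ℝ} (hf : PF 3 f) {p : Fin 3 → Fin 3 → Pt} (h : HalfGrid p)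
    (h' : HalfGrid (fun i j => p j i)) (hv : ∀ i j, (i, j) ≠ ((2, 2) : Fin 3 × Fin 3) → f (p i j) = 0) :
    f (p 2 2) = 0 :=
  chasles f hf (p 0 0) (p 0 1) (p 0 2) (p 1 0) (p 1 1) (p 1 2) (p 2 0) (p 2 1) (p 2 2)
    (h.col _ _ _ _) (h.col _ _ _ _) (h.col _ _ _ _)
    (h'.col 0 0 1 2) (h'.col 1 0 1 2) (h'.col 2 0 1 2)
    (h.ne _ _ _ (by decide)) (h.ne _ _ _ (by decide)) (h.ne _ _ _ (by decide))
    (h.ne _ _ _ (by decide)) (h.ne _ _ _ (by decide)) (h.ne _ _ _ (by decide))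
    (h.ne _ _ _ (by decide))
    (h.off _ _ _ _ _ (by decide) (by decide)) (h.off _ _ _ _ _ (by decide) (by decide))
    (h.off _ _ _ _ _ (by decide) (by decide)) (h.off _ _ _ _ _ (by decide) (by decide))
    (h.off _ _ _ _ _ (by decide) (by decide)) (h.off _ _ _ _ _ (by decide) (by decide))
    (h.off _ _ _ _ _ (by decide) (by decide))
    (h'.off 0 1 0 1 0 (by decide) (by decide)) (h'.off 1 0 0 1 0 (by decide) (by decide))
    (h'.off 2 0 0 1 0 (by decide) (by decide))
    (hv _ _ (by decide)) (hv _ _ (by decide)) (hv _ _ (by decide)) (hv _ _ (by decide))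
    (hv _ _ (by decide)) (hv _ _ (by decide)) (hv _ _ (by decide)) (hv _ _ (by decide))

theorem grid_any {f : Pt → ℝ} (hf : PF 3 f) {p : Fin 3 → Fin 3 → Pt} (h : HalfGrid p)
    (h' : HalfGrid (fun i j => p j i)) (a b : Fin 3)
    (hv : ∀ i j, ¬ (i = a ∧ j = b) → f (p i j) = 0) :
    f (p a b) = 0 := by
  have := grid_last hf (h.perm (Equiv.swap 2 a) (Equiv.swap 2 b))
    (h'.perm (Equiv.swap 2 b) (Equiv.swap 2 a)) (by
      intro i j hij
      apply hv
      rintro ⟨h1, h2⟩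
      apply hij
      have e1 : i = 2 := (Equiv.swap 2 a).injective (by simp [h1])
      have e2 : j = 2 := (Equiv.swap 2 b).injective (by simp [h2])
      rw [e1, e2])
  simpa using this

/-- The nine point window. -/
theorem Cfg.window (h : Cfg A S R ρ) {f : Pt → ℝ} (hf : PF 3 f)
    {b0 b1 b2 g0 g1 g2 r1 r2 r3 : Pt}
    (hb0 : b0 ∈ S) (hb1 : b1 ∈ S) (hb2 : b2 ∈ S) (hg0 : g0 ∈ A) (hg1 : g1 ∈ A) (hg2 : g2 ∈ A)
    (b01 : b0 ≠ b1) (b02 : b0 ≠ b2) (b12 : b1 ≠ b2)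
    (g01 : g0 ≠ g1) (g02 : g0 ≠ g2) (g12 : g1 ≠ g2)
    (r12 : r1 ≠ r2) (r13 : r1 ≠ r3) (r23 : r2 ≠ r3)
    (e21 : ρ g2 b1 = r3) (e12 : ρ g1 b2 = r3) (e02 : ρ g0 b2 = r2) (e20 : ρ g2 b0 = r2)
    (e10 : ρ g1 b0 = r1) (e01 : ρ g0 b1 = r1)
    (fb0 : f b0 = 0) (fb1 : f b1 = 0) (fg0 : f g0 = 0) (fg1 : f g1 = 0)
    (fr1 : f r1 = 0) (fr2 : f r2 = 0) :
    (f b2 = 0 → f g2 = 0 → f r3 = 0) ∧ (f b2 = 0 → f r3 = 0 → f g2 = 0) ∧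
      (f g2 = 0 → f r3 = 0 → f b2 = 0) := by
  have hr1 : r1 ∈ R := e01 ▸ h.mem _ hg0 _ hb1
  have hr2 : r2 ∈ R := e02 ▸ h.mem _ hg0 _ hb2
  have hr3 : r3 ∈ R := e12 ▸ h.mem _ hg1 _ hb2
  have dAS := fun a ha s hs => h.disj a ha s hs
  have dAR := fun a ha s hs => h.disjA a ha s hs
  have dSR := fun a ha s hs => h.disjS a ha s hs
  have H : HalfGrid ![![b1, g2, r3], ![g0, r2, b2], ![r1, b0, g1]] := by
    refine h.halfGrid _ ![g2, g0, g1] ![b1, b2, b0] ?_ ?_ ?_ ?_ ?_ ?_ ?_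
    · intro i; fin_cases i <;> simp [*]
    · intro i; fin_cases i <;> simp [*]
    · intro i j; fin_cases i <;> fin_cases j <;> simp [*]
    · intro i j k; fin_cases i <;> fin_cases j <;> fin_cases k <;> simp <;> grind
    · intro i j; fin_cases i <;> fin_cases j <;> simp <;> grind
    · intro i j; fin_cases i <;> fin_cases j <;> simp <;> grind
    · intro i j; fin_cases i <;> fin_cases j <;> simp <;> grind
  have H' : HalfGrid (fun i j => (![![b1, g2, r3], ![g0, r2, b2], ![r1, b0, g1]] :
      Fin 3 → Fin 3 → Pt) j i) := by
    refine h.halfGrid _ ![g0, g2, g1] ![b1, b0, b2] ?_ ?_ ?_ ?_ ?_ ?_ ?_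
    · intro i; fin_cases i <;> simp [*]
    · intro i; fin_cases i <;> simp [*]
    · intro i j; fin_cases i <;> fin_cases j <;> simp [*]
    · intro i j k; fin_cases i <;> fin_cases j <;> fin_cases k <;> simp <;> grind
    · intro i j; fin_cases i <;> fin_cases j <;> simp <;> grind
    · intro i j; fin_cases i <;> fin_cases j <;> simp <;> grind
    · intro i j; fin_cases i <;> fin_cases j <;> simp <;> grind
  refine ⟨fun fb2 fg2 => ?_, fun fb2 fr3 => ?_, fun fg2 fr3 => ?_⟩
  · refine grid_any hf H H' 0 2 ?_
    intro i j; fin_cases i <;> fin_cases j <;> simp [*]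
  · refine grid_any hf H H' 0 1 ?_
    intro i j; fin_cases i <;> fin_cases j <;> simp [*]
  · refine grid_any hf H H' 1 2 ?_
    intro i j; fin_cases i <;> fin_cases j <;> simp [*]

theorem Cfg.exists_cubic (h : Cfg A S R ρ) (h3 : 3 ≤ S.card) :
    ∃ f : MvPolynomial (Fin 2) ℝ, f ≠ 0 ∧ f.totalDegree ≤ 3 ∧
      (∀ p ∈ A, MvPolynomial.eval p f = 0) ∧ (∀ p ∈ S, MvPolynomial.eval p f = 0) ∧
      (∀ p ∈ R, MvPolynomial.eval p f = 0) := by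
  obtain ⟨g, b, r, hg, hb, hρ, sb, sg, sr, hd⟩ := h.struct
  have hd := hd h3
  have hgi : ∀ i k, b i ≠ b (i + k) → g i ≠ g (i + k) := by
    intro i k hk e
    have e1 := hρ i (i + k)
    have e2 := hρ (i + k) i
    rw [← e] at e2
    apply hk
    apply h.injS (g i) (hg i) _ (hb _) _ (hb _)
    rw [e1, e2, add_comm]
  have hri : ∀ i k, b i ≠ b k → r i ≠ r k := by
    intro i k hk e
    apply hk
    apply h.injS (g 0) (hg 0) _ (hb _) _ (hb _)
    rw [hρ, hρ, zero_add, zero_add, e]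
  let L : List Pt := [b 0, b 1, b 2, b 3, g 0, g 1, g 2, r 1, r 2]
  classical
  obtain ⟨f, f0, fd, hf, hv⟩ := _root_.exists_cubic L.toFinset (by
    refine (List.toFinset_card_le L).trans ?_
    simp [L])
  refine ⟨f, f0, fd, ?_⟩
  have W : ∀ s t, MvPolynomial.eval (b s) f = 0 → MvPolynomial.eval (b (s + 1)) f = 0 →
      MvPolynomial.eval (g t) f = 0 → MvPolynomial.eval (g (t + 1)) f = 0 →
      MvPolynomial.eval (r (s + t + 1)) f = 0 → MvPolynomial.eval (r (s + t + 2)) f = 0 →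
      (MvPolynomial.eval (b (s + 2)) f = 0 → MvPolynomial.eval (g (t + 2)) f = 0 →
        MvPolynomial.eval (r (s + t + 3)) f = 0) ∧
      (MvPolynomial.eval (b (s + 2)) f = 0 → MvPolynomial.eval (r (s + t + 3)) f = 0 →
        MvPolynomial.eval (g (t + 2)) f = 0) ∧
      (MvPolynomial.eval (g (t + 2)) f = 0 → MvPolynomial.eval (r (s + t + 3)) f = 0 →
        MvPolynomial.eval (b (s + 2)) f = 0) := by
    intro s t
    exact h.window hf (hb s) (hb (s + 1)) (hb (s + 2)) (hg t) (hg (t + 1)) (hg (t + 2))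
      (hd s).1 (hd s).2 (hd (s + 1)).1 (hgi _ _ (hd t).1) (hgi _ _ (hd t).2)
      (hgi _ _ (hd (t + 1)).1) (hri _ _ (hd _).1) (hri _ _ (hd _).2) (hri _ _ (hd _).1)
      (by rw [hρ]; congr 1; ring) (by rw [hρ]; congr 1; ring) (by rw [hρ]; congr 1; ring)
      (by rw [hρ]; congr 1; ring) (by rw [hρ]; congr 1; ring) (by rw [hρ]; congr 1; ring)
  have b0 := hv (b 0) (by simp [L])
  have b1 := hv (b 1) (by simp [L])
  have b2 := hv (b 2) (by simp [L])
  have b3 := hv (b 3) (by simp [L])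
  have g0 := hv (g 0) (by simp [L])
  have g1 := hv (g 1) (by simp [L])
  have g2 := hv (g 2) (by simp [L])
  have r1 := hv (r 1) (by simp [L])
  have r2 := hv (r 2) (by simp [L])
  have r3 := (W 0 0 b0 b1 g0 g1 r1 r2).1 b2 g2
  have r4 := (W 1 0 b1 b2 g0 g1 r2 r3).1 b3 g2
  have g3 := (W 0 1 b0 b1 g1 g2 r2 r3).2.1 b2 r4
  have r5 := (W 1 1 b1 b2 g1 g2 r3 r4).1 b3 g3
  have main : ∀ m : ℕ, (∀ j ≤ m + 3, MvPolynomial.eval (b j) f = 0) ∧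
      (∀ j ≤ m + 3, MvPolynomial.eval (g j) f = 0) ∧
      (∀ j ≤ m + m + 4, MvPolynomial.eval (r (j + 1)) f = 0) := by
    intro m
    induction m with
    | zero =>
      refine ⟨?_, ?_, ?_⟩ <;> intro j hj
      · interval_cases j <;> assumption
      · interval_cases j <;> assumption
      · interval_cases j <;> assumption
    | succ m ih =>
      obtain ⟨ib, ig, ir⟩ := ih
      have ir' : ∀ k, 1 ≤ k → k ≤ m + m + 5 → MvPolynomial.eval (r k) f = 0 := by
        intro k h1 h2
        obtain ⟨k, rfl⟩ := Nat.exists_eq_add_of_le' h1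
        exact ir k (by omega)
      have nb : MvPolynomial.eval (b (m + 4)) f = 0 :=
        (W (m + 2) 0 (ib _ (by omega)) (ib _ (by omega)) g0 g1 (ir' _ (by omega) (by omega))
          (ir' _ (by omega) (by omega))).2.2 g2 (ir' _ (by omega) (by omega))
      have ng : MvPolynomial.eval (g (m + 4)) f = 0 :=
        (W 0 (m + 2) b0 b1 (ig _ (by omega)) (ig _ (by omega)) (ir' _ (by omega) (by omega))
          (ir' _ (by omega) (by omega))).2.1 b2 (ir' _ (by omega) (by omega))
      have nr : MvPolynomial.eval (r (m + m + 6)) f = 0 := by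
        have := (W (m + 2) (m + 1) (ib _ (by omega)) (ib _ (by omega)) (ig _ (by omega))
          (ig _ (by omega)) (ir' _ (by omega) (by omega))
          (ir' _ (by omega) (by omega))).1 nb (ig _ (by omega))
        rwa [show m + 2 + (m + 1) + 3 = m + m + 6 by ring] at this
      have nr' : MvPolynomial.eval (r (m + m + 7)) f = 0 := by
        have := (W (m + 2) (m + 2) (ib _ (by omega)) (ib _ (by omega)) (ig _ (by omega))
          (ig _ (by omega)) (ir' _ (by omega) (by omega))
          (by rw [show m + 2 + (m + 2) + 2 = m + m + 6 by ring]; exact nr)).1 nb ng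
        rwa [show m + 2 + (m + 2) + 3 = m + m + 7 by ring] at this
      refine ⟨?_, ?_, ?_⟩ <;> intro j hj
      · rcases Nat.lt_or_ge j (m + 4) with hlt | hge
        · exact ib j (by omega)
        · rwa [show j = m + 4 by omega]
      · rcases Nat.lt_or_ge j (m + 4) with hlt | hge
        · exact ig j (by omega)
        · rwa [show j = m + 4 by omega]
      · rcases Nat.lt_or_ge j (m + m + 5) with hlt | hge
        · exact ir j (by omega)
        · rcases Nat.eq_or_lt_of_le hge with he | he
          · rw [← he]; exact nr
          · rw [show j = m + m + 6 by omega]; exact nr'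
  refine ⟨fun p hp => ?_, fun p hp => ?_, fun p hp => ?_⟩
  · obtain ⟨j, rfl⟩ := sg p hp
    exact (main j).2.1 j (by omega)
  · obtain ⟨j, rfl⟩ := sb p hp
    exact (main j).1 j (by omega)
  · obtain ⟨j, rfl⟩ := sr p hp
    exact (main j).2.2 j (by omega)

end

theorem collinear_of_dt {x y z : Pt} (hxy : x ≠ y) (h : dt x y z = 0) :
    Collinear ℝ ({x, y, z} : Set Pt) := by
  rw [collinear_iff_of_mem (p₀ := x) (by simp)]
  refine ⟨y - x, ?_⟩
  have key : ∃ t : ℝ, z = t • (y - x) + x := by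
    by_cases h0 : y 0 - x 0 = 0
    · have h1 : y 1 - x 1 ≠ 0 := by
        intro h1
        apply hxy
        ext i
        fin_cases i
        · exact (sub_eq_zero.1 h0).symm
        · exact (sub_eq_zero.1 h1).symm
      have hz : z 0 - x 0 = 0 := by
        unfold dt at h
        rw [h0] at h
        have : (y 1 - x 1) * (z 0 - x 0) = 0 := by linarith
        exact (mul_eq_zero.1 this).resolve_left h1
      refine ⟨(z 1 - x 1) / (y 1 - x 1), ?_⟩
      ext i
      fin_cases i
      · simp [h0]; linarith
      · simp; field_simp; ring
    · refine ⟨(z 0 - x 0) / (y 0 - x 0), ?_⟩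
      unfold dt at h
      ext i
      fin_cases i
      · simp; field_simp; ring
      · simp; field_simp; linarith
  intro p hp
  simp only [Set.mem_insert_iff, Set.mem_singleton_iff] at hp
  rcases hp with rfl | rfl | rfl
  · exact ⟨0, by simp⟩
  · exact ⟨1, by simp⟩
  · obtain ⟨t, ht⟩ := key
    exact ⟨t, by rw [vadd_eq_add]; exact ht⟩

theorem line_of_collinear {b g r : Pt} (hbg : b ≠ g)
    (hc : Collinear ℝ ({b, g, r} : Set Pt)) (hs : r ∉ segment ℝ b g) :
    ∃ t : ℝ, 0 < t * (t - 1) ∧ ∀ i, r i = b i + t * (g i - b i) := by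
  rw [collinear_iff_of_mem (p₀ := b) (by simp)] at hc
  obtain ⟨v, hv⟩ := hc
  obtain ⟨c, hc⟩ := hv g (by simp)
  obtain ⟨d, hd⟩ := hv r (by simp)
  have hc0 : c ≠ 0 := by
    rintro rfl
    apply hbg
    rw [hc]; simp
  have e : ∀ i, r i = b i + d / c * (g i - b i) := by
    intro i
    rw [hd, hc]
    simp
    field_simp
    ring
  refine ⟨d / c, ?_, e⟩
  by_contra hneg
  apply hs
  have h1 : 0 ≤ d / c := by nlinarith
  have h2 : d / c ≤ 1 := by nlinarith
  refine ⟨1 - d / c, d / c, by linarith, h1, by ring, ?_⟩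
  ext i
  rw [e i]
  simp
  ring

theorem stmt16 (n : ℕ) (B G R : Finset Pt)
    (hB : B.card = n) (hG : G.card = n) (hR : R.card = n)
    (hBG : Disjoint B G) (hBR : Disjoint B R) (hGR : Disjoint G R)
    (hgp : GenPos ↑(B ∪ G))
    (hpierce : ∀ b ∈ B, ∀ g ∈ G, ∃ r ∈ R,
      Collinear ℝ ({b, g, r} : Set Pt) ∧ r ∉ segment ℝ b g) :
    ∃ f : MvPolynomial (Fin 2) ℝ, f ≠ 0 ∧ f.totalDegree ≤ 3 ∧
      ∀ p ∈ B ∪ G ∪ R, MvPolynomial.eval p f = 0 := by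
  rcases Nat.lt_or_ge n 4 with hn | hn
  · obtain ⟨f, h0, h1, -, h2⟩ := exists_cubic (B ∪ G ∪ R) (by
      have h1 := Finset.card_union_le (B ∪ G) R
      have h2 := Finset.card_union_le B G
      omega)
    exact ⟨f, h0, h1, h2⟩
  have dBG : ∀ a ∈ B, ∀ s ∈ G, a ≠ s := fun a ha s hs => Finset.disjoint_iff_ne.1 hBG a ha s hs
  have gp : ∀ x ∈ B ∪ G, ∀ y ∈ B ∪ G, ∀ z ∈ B ∪ G, x ≠ y → x ≠ z → y ≠ z → dt x y z ≠ 0 :=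
    fun x hx y hy z hz h1 h2 h3 h => hgp x (Finset.mem_coe.2 hx) y (Finset.mem_coe.2 hy) z
      (Finset.mem_coe.2 hz) h1 h2 h3 (collinear_of_dt h1 h)
  have hp : ∀ b g : Pt, ∃ r : Pt, b ∈ B → g ∈ G → r ∈ R ∧
      ∃ t : ℝ, 0 < t * (t - 1) ∧ ∀ i, r i = b i + t * (g i - b i) := by
    intro b g
    by_cases hb : b ∈ B
    · by_cases hg : g ∈ G
      · obtain ⟨r, hr, h1, h2⟩ := hpierce b hb g hg
        exact ⟨r, fun _ _ => ⟨hr, line_of_collinear (dBG b hb g hg) h1 h2⟩⟩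
      · exact ⟨b, fun _ h => absurd h hg⟩
    · exact ⟨b, fun h => absurd h hb⟩
  choose ρ hρ using hp
  have tne : ∀ t : ℝ, 0 < t * (t - 1) → t ≠ 0 ∧ t - 1 ≠ 0 := fun t ht =>
    ⟨left_ne_zero_of_mul ht.ne', right_ne_zero_of_mul ht.ne'⟩
  have mem : ∀ a ∈ B, ∀ s ∈ G, ρ a s ∈ R := fun a ha s hs => (hρ a s ha hs).1
  have injS : ∀ a ∈ B, ∀ s ∈ G, ∀ s' ∈ G, ρ a s = ρ a s' → s = s' := by
    intro a ha s hs s' hs' e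
    by_contra hne
    obtain ⟨-, t, ht, h1⟩ := hρ a s ha hs
    obtain ⟨-, t', ht', h1'⟩ := hρ a s' ha hs'
    apply gp a (by simp [ha]) s (by simp [hs]) s' (by simp [hs']) (dBG a ha s hs)
      (dBG a ha s' hs') hne
    rw [e] at h1
    have e0 := (h1' 0).symm.trans (h1 0)
    have e1 := (h1' 1).symm.trans (h1 1)
    have : t' * dt a s s' = 0 := by
      unfold dt
      linear_combination (s 0 - a 0) * e1 - (s 1 - a 1) * e0
    exact (mul_eq_zero.1 this).resolve_left (tne t' ht').1
  have injA : ∀ s ∈ G, ∀ a ∈ B, ∀ a' ∈ B, ρ a s = ρ a' s → a = a' := by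
    intro s hs a ha a' ha' e
    by_contra hne
    obtain ⟨-, t, ht, h1⟩ := hρ a s ha hs
    obtain ⟨-, t', ht', h1'⟩ := hρ a' s ha' hs
    apply gp s (by simp [hs]) a (by simp [ha]) a' (by simp [ha']) (dBG a ha s hs).symm
      (dBG a' ha' s hs).symm hne
    rw [e] at h1
    have e0 := (h1' 0).symm.trans (h1 0)
    have e1 := (h1' 1).symm.trans (h1 1)
    have : (t' - 1) * dt s a a' = 0 := by
      unfold dt
      linear_combination (-(a 0 - s 0)) * e1 + (a 1 - s 1) * e0
    exact (mul_eq_zero.1 this).resolve_left (tne t' ht').2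
  have surjS : ∀ a ∈ B, ∀ r ∈ R, ∃ s ∈ G, ρ a s = r := by
    intro a ha r hr
    have := Finset.surjOn_of_injOn_of_card_le (s := G) (t := R) (ρ a)
      (fun s hs => mem a ha s hs) (fun s hs s' hs' e => injS a ha s hs s' hs' e)
      (by omega)
    obtain ⟨s, hs, e⟩ := this hr
    exact ⟨s, hs, e⟩
  have surjA : ∀ s ∈ G, ∀ r ∈ R, ∃ a ∈ B, ρ a s = r := by
    intro s hs r hr
    have := Finset.surjOn_of_injOn_of_card_le (s := B) (t := R) (fun a => ρ a s)
      (fun a ha => mem a ha s hs) (fun a ha a' ha' e => injA s hs a ha a' ha' e)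
      (by omega)
    obtain ⟨a, ha, e⟩ := this hr
    exact ⟨a, ha, e⟩
  have C : Cfg B G R ρ :=
    { disj := dBG
      disjA := fun a ha s hs => Finset.disjoint_iff_ne.1 hBR a ha s hs
      disjS := fun a ha s hs => Finset.disjoint_iff_ne.1 hGR a ha s hs
      gp := gp
      mem := mem
      surjS := surjS
      surjA := surjA
      injS := injS
      injA := injA
      line := fun a ha s hs => (hρ a s ha hs).2
      cardA := by omega
      cardEq := by omega }
  obtain ⟨f, f0, fd, hA, hS, hRr⟩ := C.exists_cubic (by omega)
  refine ⟨f, f0, fd, fun p hp => ?_⟩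
  rw [Finset.mem_union, Finset.mem_union] at hp
  rcases hp with (hp | hp) | hp
  · exact hA p hp
  · exact hS p hp
  · exact hRr p hp
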